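/- For every a ∈ [0,2], the set K_a = {x ∈ [0,1] : the frequencies ν_0(x), ν_1(x), ν_2(x) all exist and ν_1(x) + 2·ν_2(x) = a} is dense in the interval [0,1]. -/

import Mathlib

open Filter

/-- The `n`-th ternary digit of `x`: `⌊3^n x⌋ mod 3`. -/
noncomputable def ternDigit (x : ℝ) (n : ℕ) : ℤ := ⌊(3 : ℝ) ^ n * x⌋ % 3

/-- `N_i(x,k)`: the number of indices `1 ≤ n ≤ k` with `α_n(x) = i`. -/
noncomputable def digitCount (i : ℤ) (x : ℝ) (k : ℕ) : ℕ :=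
  ((Finset.Icc 1 k).filter (fun n => ternDigit x n = i)).card

/-- The frequency `ν_i(x)` exists and equals `v`. -/
def hasFreq (i : ℤ) (x : ℝ) (v : ℝ) : Prop :=
  Tendsto (fun k : ℕ => (digitCount i x k : ℝ) / k) atTop (nhds v)

/-- The asymptotic mean of digits `r(x)` exists and equals `r`. -/
def hasMean (x : ℝ) (r : ℝ) : Prop :=
  Tendsto (fun n : ℕ => (1 / (n : ℝ)) * ∑ k ∈ Finset.Icc 1 n, (ternDigit x k : ℝ))
    atTop (nhds r)

theorem three_mul_ofDigits (e : ℕ → Fin 3) :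
    3 * Real.ofDigits e = ((e 0 : ℕ) : ℝ) + Real.ofDigits (fun i => e (i + 1)) := by
  rw [Real.ofDigits_eq_sum_add_ofDigits e 1]
  simp [Real.ofDigitsTerm]
  ring

theorem eq_two_of_ofDigits_eq_one (n : ℕ) :
    ∀ e : ℕ → Fin 3, Real.ofDigits e = 1 → e n = 2 := by
  have shift : ∀ e : ℕ → Fin 3, Real.ofDigits e = 1 →
      e 0 = 2 ∧ Real.ofDigits (fun i => e (i + 1)) = 1 := by
    intro e he
    have h := three_mul_ofDigits e
    have h1 := Real.ofDigits_le_one (fun i => e (i + 1))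
    have h2 : (2 : ℝ) ≤ ((e 0 : ℕ) : ℝ) := by linarith
    have h3 : 2 ≤ (e 0 : ℕ) := by exact_mod_cast h2
    have h4 : (e 0 : ℕ) = 2 := by omega
    refine ⟨Fin.ext h4, ?_⟩
    rw [h4] at h
    push_cast at h
    linarith
  induction n with
  | zero => exact fun e he => (shift e he).1
  | succ n ih => exact fun e he => ih _ (shift e he).2

theorem ofDigits_lt_one {e : ℕ → Fin 3} (he : ∃ n, e n ≠ 2) : Real.ofDigits e < 1 :=
  lt_of_le_of_ne (Real.ofDigits_le_one e) fun h =>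
    he.elim fun n hn => hn (eq_two_of_ofDigits_eq_one n e h)

theorem exists_pow_mul_ofDigits_eq (e : ℕ → Fin 3) (n : ℕ) :
    ∃ m : ℤ, (3 : ℝ) ^ n * Real.ofDigits e = m + Real.ofDigits (fun i => e (i + n)) := by
  induction n with
  | zero => exact ⟨0, by simp⟩
  | succ n ih =>
    obtain ⟨m, hm⟩ := ih
    have h := three_mul_ofDigits (fun i => e (i + n))
    refine ⟨3 * m + ((e n : ℕ) : ℤ), ?_⟩
    rw [pow_succ', mul_assoc, hm, mul_add, h]
    simp only [zero_add, Nat.add_right_comm _ 1 n]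
    push_cast
    simp only [add_assoc]

theorem ternDigit_ofDigits {e : ℕ → Fin 3} (he : ∀ n, ∃ m, e (m + n) ≠ 2) (n : ℕ) :
    ternDigit (Real.ofDigits e) (n + 1) = ((e n : ℕ) : ℤ) := by
  obtain ⟨m, hm⟩ := exists_pow_mul_ofDigits_eq e n
  have h := three_mul_ofDigits (fun i => e (i + n))
  simp only [zero_add, Nat.add_right_comm _ 1 n] at h
  have hfloor : ⌊(3 : ℝ) ^ (n + 1) * Real.ofDigits e⌋ = 3 * m + ((e n : ℕ) : ℤ) := by
    rw [pow_succ', mul_assoc, hm, mul_add, h, Int.floor_eq_iff]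
    have h0 := Real.ofDigits_nonneg (fun i => e (i + n + 1))
    have h1 := ofDigits_lt_one (he (n + 1))
    simp only [← add_assoc] at h1
    push_cast
    constructor <;> linarith
  rw [ternDigit, hfloor]
  omega

theorem ternDigit_add_div_pow (m : ℤ) (y : ℝ) (N n : ℕ) (hn : 1 ≤ n) :
    ternDigit ((m + y) / 3 ^ N) (N + n) = ternDigit y n := by
  obtain ⟨n, rfl⟩ := Nat.exists_eq_add_of_le' hn
  have h : (3 : ℝ) ^ (N + (n + 1)) * ((m + y) / 3 ^ N)
      = 3 ^ (n + 1) * y + ((3 * (3 ^ n * m) : ℤ) : ℝ) := by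
    push_cast
    field_simp
    ring
  rw [ternDigit, h, Int.floor_add_intCast, ternDigit, Int.add_mul_emod_self_left]

theorem digitCount_succ (i : ℤ) (x : ℝ) (k : ℕ) :
    digitCount i x (k + 1) = digitCount i x k + if ternDigit x (k + 1) = i then 1 else 0 := by
  rw [digitCount, ← Finset.insert_Icc_right_eq_Icc_add_one (by omega), Finset.filter_insert]
  split_ifs
  · rw [Finset.card_insert_of_notMem (by simp), digitCount]
  · rfl

theorem digitCount_add_div_pow (i m : ℤ) (y : ℝ) (N k : ℕ) :
    digitCount i ((m + y) / 3 ^ N) (k + N)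
      = digitCount i ((m + y) / 3 ^ N) N + digitCount i y k := by
  induction k with
  | zero => simp [digitCount]
  | succ k ih =>
    rw [Nat.add_right_comm, digitCount_succ, ih, digitCount_succ, add_assoc k N 1, add_comm k,
      add_assoc N, add_comm 1 k, ternDigit_add_div_pow m y N (k + 1) (by omega), add_assoc]

theorem hasFreq.add_div_pow {i : ℤ} {y v : ℝ} (h : hasFreq i y v) (m : ℤ) (N : ℕ) :
    hasFreq i ((m + y) / 3 ^ N) v := by
  rw [hasFreq, ← tendsto_add_atTop_iff_nat N]
  have h1 : Tendsto (fun k : ℕ => (k : ℝ) / (k + (N : ℝ))) atTop (nhds 1) :=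
    tendsto_natCast_div_add_atTop _
  have h2 : Tendsto (fun k : ℕ => (digitCount i ((m + y) / 3 ^ N) N : ℝ) / ((k + N : ℕ) : ℝ))
      atTop (nhds 0) :=
    (tendsto_add_atTop_iff_nat (f := fun k : ℕ =>
      (digitCount i ((m + y) / 3 ^ N) N : ℝ) / (k : ℝ)) N).2
      (tendsto_const_div_atTop_nhds_zero_nat _)
  have h3 := h2.add (h1.mul h)
  rw [zero_add, one_mul] at h3
  refine h3.congr' ?_
  filter_upwards [eventually_gt_atTop 0] with k hk
  rw [digitCount_add_div_pow]
  push_cast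
  field_simp

/-- A nondecreasing counting function with asymptotic density `b` whose increments are at most one
and vanish just before every perfect square. -/
noncomputable def sparseFloor (b : ℝ) (k : ℕ) : ℕ := ⌊b * ((k - Nat.sqrt k : ℕ) : ℝ)⌋₊

theorem sub_sqrt_succ (k : ℕ) :
    k + 1 - Nat.sqrt (k + 1) = k - Nat.sqrt k ∨ k + 1 - Nat.sqrt (k + 1) = k - Nat.sqrt k + 1 := by
  have h1 := Nat.sqrt_succ_le_succ_sqrt k
  have h2 := Nat.sqrt_le_sqrt (Nat.le_succ k)
  have h3 := Nat.sqrt_le_self k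
  simp only [Nat.succ_eq_add_one] at *
  omega

theorem sparseFloor_succ {b : ℝ} (hb : b ∈ Set.Icc (0 : ℝ) 1) (k : ℕ) :
    sparseFloor b (k + 1) = sparseFloor b k ∨ sparseFloor b (k + 1) = sparseFloor b k + 1 := by
  obtain h | h := sub_sqrt_succ k
  · left
    rw [sparseFloor, h, sparseFloor]
  · have h1 : sparseFloor b k ≤ sparseFloor b (k + 1) := by
      rw [sparseFloor, sparseFloor, h]
      refine Nat.floor_mono (mul_le_mul_of_nonneg_left ?_ hb.1)
      exact_mod_cast Nat.le_succ _
    have h2 : sparseFloor b (k + 1) ≤ sparseFloor b k + 1 := by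
      rw [sparseFloor, sparseFloor, h, ← Nat.floor_add_one (mul_nonneg hb.1 (Nat.cast_nonneg _))]
      refine Nat.floor_mono ?_
      push_cast
      nlinarith [hb.2]
    omega

theorem exists_sparseFloor_succ_eq (b : ℝ) (n : ℕ) :
    ∃ m, sparseFloor b (m + n + 1) = sparseFloor b (m + n) := by
  refine ⟨n * n + n, ?_⟩
  have h1 : Nat.sqrt (n * n + n + n + 1) = n + 1 := by
    rw [show n * n + n + n + 1 = (n + 1) * (n + 1) by ring, Nat.sqrt_eq]
  have h2 : Nat.sqrt (n * n + n + n) = n := by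
    rw [add_assoc]
    exact Nat.sqrt_add_eq n le_rfl
  rw [sparseFloor, sparseFloor, h1, h2, Nat.add_sub_add_right]

theorem tendsto_sub_sqrt_div :
    Tendsto (fun k : ℕ => ((k - Nat.sqrt k : ℕ) : ℝ) / k) atTop (nhds 1) := by
  have h : Tendsto (fun k : ℕ => (Nat.sqrt k : ℝ) / k) atTop (nhds 0) := by
    have h0 : Tendsto (fun k : ℕ => (√(k : ℝ))⁻¹) atTop (nhds 0) :=
      tendsto_inv_atTop_zero.comp (Real.tendsto_sqrt_atTop.comp tendsto_natCast_atTop_atTop)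
    refine squeeze_zero (fun k => by positivity) (fun k => ?_) h0
    rw [← Real.sqrt_div_self]
    gcongr
    exact Real.nat_sqrt_le_real_sqrt
  have h1 := (tendsto_const_nhds (x := (1 : ℝ))).sub h
  rw [sub_zero] at h1
  refine h1.congr' ?_
  filter_upwards [eventually_gt_atTop 0] with k hk
  rw [Nat.cast_sub (Nat.sqrt_le_self k)]
  field_simp

theorem tendsto_sub_sqrt : Tendsto (fun k : ℕ => ((k - Nat.sqrt k : ℕ) : ℝ)) atTop atTop := by
  have h := tendsto_sub_sqrt_div.pos_mul_atTop one_pos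
    (tendsto_natCast_atTop_atTop (R := ℝ))
  refine h.congr' ?_
  filter_upwards [eventually_gt_atTop 0] with k hk
  field_simp

theorem tendsto_sparseFloor_div {b : ℝ} (hb : 0 ≤ b) :
    Tendsto (fun k : ℕ => (sparseFloor b k : ℝ) / k) atTop (nhds b) := by
  have h := ((tendsto_nat_floor_mul_div_atTop hb).comp tendsto_sub_sqrt).mul tendsto_sub_sqrt_div
  rw [mul_one] at h
  refine h.congr' ?_
  filter_upwards [tendsto_sub_sqrt.eventually_gt_atTop 0] with k hk
  exact div_mul_div_cancel₀ hk.ne'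

theorem exists_hasFreq {b : ℝ} (hb : b ∈ Set.Icc (0 : ℝ) 1) :
    ∃ y ∈ Set.Ico (0 : ℝ) 1, hasFreq 0 y (1 - b) ∧ hasFreq 1 y 0 ∧ hasFreq 2 y b := by
  let e : ℕ → Fin 3 := fun n => if sparseFloor b (n + 1) = sparseFloor b n then 0 else 2
  have he : ∀ n, ∃ m, e (m + n) ≠ 2 := fun n => by
    obtain ⟨m, hm⟩ := exists_sparseFloor_succ_eq b n
    exact ⟨m, by simp [e, hm]⟩
  have hdigit : ∀ n, ternDigit (Real.ofDigits e) (n + 1)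
      = if sparseFloor b (n + 1) = sparseFloor b n then 0 else 2 := fun n => by
    rw [ternDigit_ofDigits he]
    simp only [e]
    split_ifs <;> rfl
  have h1 : ∀ k, digitCount 1 (Real.ofDigits e) k = 0 := fun k => by
    induction k with
    | zero => simp [digitCount]
    | succ k ih => rw [digitCount_succ, ih, hdigit]; split_ifs <;> simp_all
  have h2 : ∀ k, digitCount 2 (Real.ofDigits e) k = sparseFloor b k := fun k => by
    induction k with
    | zero => simp [digitCount, sparseFloor]
    | succ k ih =>
      rw [digitCount_succ, ih, hdigit]
      obtain h | h := sparseFloor_succ hb k <;> simp [h]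
  have h0 : ∀ k, digitCount 0 (Real.ofDigits e) k + sparseFloor b k = k := fun k => by
    induction k with
    | zero => simp [digitCount, sparseFloor]
    | succ k ih =>
      rw [digitCount_succ, hdigit]
      obtain h | h := sparseFloor_succ hb k <;> simp [h] <;> omega
  refine ⟨Real.ofDigits e, ⟨Real.ofDigits_nonneg e, ofDigits_lt_one (he 0)⟩, ?_, ?_, ?_⟩
  · refine ((tendsto_const_nhds (x := (1 : ℝ))).sub (tendsto_sparseFloor_div hb.1)).congr' ?_
    filter_upwards [eventually_gt_atTop 0] with k hk
    have h : (digitCount 0 (Real.ofDigits e) k : ℝ) + sparseFloor b k = k := by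
      exact_mod_cast h0 k
    rw [eq_sub_of_add_eq h]
    field_simp
  · simp [hasFreq, h1]
  · simpa only [hasFreq, h2] using tendsto_sparseFloor_div hb.1

/-- For every `a ∈ [0,2]`, the set `K_a` is dense in `[0,1]`. -/
theorem K_a_dense (a : ℝ) (ha : a ∈ Set.Icc (0 : ℝ) 2) :
    Set.Icc (0 : ℝ) 1 ⊆
      closure {x ∈ Set.Icc (0 : ℝ) 1 |
        ∃ v0 v1 v2 : ℝ, hasFreq 0 x v0 ∧ hasFreq 1 x v1 ∧ hasFreq 2 x v2 ∧
          v1 + 2 * v2 = a} := by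
  obtain ⟨y, hy, hy0, hy1, hy2⟩ := exists_hasFreq (b := a / 2)
    ⟨by linarith [ha.1], by linarith [ha.2]⟩
  refine (closure_Ico (zero_ne_one (α := ℝ))).symm.subset.trans
    (closure_minimal (fun t ht => Metric.mem_closure_iff.2 fun ε hε => ?_) isClosed_closure)
  obtain ⟨N, hN⟩ := exists_pow_lt_of_lt_one hε (show (1 / 3 : ℝ) < 1 by norm_num)
  have hpos : (0 : ℝ) < 3 ^ N := by positivity
  have hm0 : 0 ≤ ⌊(3 : ℝ) ^ N * t⌋ := Int.floor_nonneg.2 (mul_nonneg hpos.le ht.1)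
  have hm1 : ⌊(3 : ℝ) ^ N * t⌋ + 1 ≤ 3 ^ N := by
    refine Int.add_one_le_iff.2 (Int.floor_lt.2 ?_)
    push_cast
    nlinarith [ht.2]
  have hle := Int.floor_le ((3 : ℝ) ^ N * t)
  have hlt := Int.lt_floor_add_one ((3 : ℝ) ^ N * t)
  generalize ⌊(3 : ℝ) ^ N * t⌋ = m at *
  have hm0' : (0 : ℝ) ≤ m := by exact_mod_cast hm0
  have hm1' : (m : ℝ) + 1 ≤ 3 ^ N := by exact_mod_cast hm1
  refine ⟨(m + y) / 3 ^ N, ⟨⟨div_nonneg (add_nonneg hm0' hy.1) hpos.le, ?_⟩,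
    1 - a / 2, 0, a / 2, hy0.add_div_pow m N, hy1.add_div_pow m N, hy2.add_div_pow m N,
    by ring⟩, ?_⟩
  · rw [div_le_one hpos]
    linarith [hy.2]
  · refine lt_of_lt_of_le ?_ hN.le
    have h : t - (m + y) / 3 ^ N = (3 ^ N * t - (m + y)) / 3 ^ N := by field_simp
    rw [Real.dist_eq, h, abs_div, abs_of_pos hpos, one_div_pow]
    refine div_lt_div_of_pos_right (abs_lt.2 ⟨?_, ?_⟩) hpos <;> linarith [hy.1, hy.2]
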